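/- For all integers 1 ≤ r < s ≤ k one has −i·(conj(u_r) − conj(u_s)) = 2k·sin(π(s−r)/k)·exp(i·(2π/k − π(r+s)/k)), and sin(π(s−r)/k) > 0. Consequently the Stokes ray R_{rs} is the open ray {ρ·exp(i·(2π/k − π(r+s)/k)) : ρ > 0}, and R_{sr} = −R_{rs}. -/

import Mathlib

open Complex Real

/-- The canonical coordinates `u_n = k·exp(2πi(n-1)/k)` of the quantum cohomology of
`CP^{k-1}` (1-based indexing). -/
noncomputable def ucan (k n : ℕ) : ℂ :=
  (k : ℂ) * Complex.exp (2 * (π : ℂ) * Complex.I * ((n : ℂ) - 1) / (k : ℂ))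

/-- The Stokes ray `R_{rs} = { -iρ·(conj u_r - conj u_s) : ρ > 0 }`. -/
noncomputable def stokesRay (k r s : ℕ) : Set ℂ :=
  {z | ∃ ρ : ℝ, 0 < ρ ∧
    z = -Complex.I * (ρ : ℂ) * ((starRingEnd ℂ) (ucan k r) - (starRingEnd ℂ) (ucan k s))}

theorem conj_ucan (k n : ℕ) :
    (starRingEnd ℂ) (ucan k n) =
      (k : ℂ) * Complex.exp (-(2 * (π : ℂ) * Complex.I * ((n : ℂ) - 1) / (k : ℂ))) := by
  simp [ucan, ← Complex.exp_conj, neg_div, Complex.conj_ofNat]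

theorem neg_I_mul_conj_ucan_sub (k r s : ℕ) :
    -Complex.I * ((starRingEnd ℂ) (ucan k r) - (starRingEnd ℂ) (ucan k s))
      = 2 * (k : ℂ) * (Real.sin (π * ((s : ℝ) - r) / k) : ℂ) *
          Complex.exp (Complex.I * (2 * (π : ℂ) / k - (π : ℂ) * ((r : ℂ) + s) / k)) := by
  set A : ℂ := Complex.I * (2 * (π : ℂ) / k - (π : ℂ) * ((r : ℂ) + s) / k) with hA
  set x : ℂ := (π : ℂ) * ((s : ℂ) - r) / k with hx
  have hr : -(2 * (π : ℂ) * Complex.I * ((r : ℂ) - 1) / (k : ℂ)) = A + x * Complex.I := by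
    rw [hA, hx]; ring
  have hs : -(2 * (π : ℂ) * Complex.I * ((s : ℂ) - 1) / (k : ℂ)) = A + -x * Complex.I := by
    rw [hA, hx]; ring
  have hsin : (Real.sin (π * ((s : ℝ) - r) / k) : ℂ) = Complex.sin x := by
    rw [hx]; push_cast; rfl
  rw [conj_ucan, conj_ucan, hr, hs, hsin, Complex.exp_add, Complex.exp_add, Complex.sin]
  ring

theorem sin_pi_mul_sub_div_pos {k r s : ℕ} (hr : 1 ≤ r) (hrs : r < s) (hs : s ≤ k) :
    0 < Real.sin (π * ((s : ℝ) - r) / k) := by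
  have hr' : (1 : ℝ) ≤ r := by exact_mod_cast hr
  have hrs' : (r : ℝ) < s := by exact_mod_cast hrs
  have hs' : (s : ℝ) ≤ k := by exact_mod_cast hs
  have hk : (0 : ℝ) < k := by linarith
  apply Real.sin_pos_of_pos_of_lt_pi
  · exact div_pos (mul_pos Real.pi_pos (by linarith)) hk
  · rw [div_lt_iff₀ hk]
    exact mul_lt_mul_of_pos_left (by linarith) Real.pi_pos

theorem stokesRay_swap (k r s : ℕ) : stokesRay k s r = -(stokesRay k r s) := by
  ext z
  rw [Set.mem_neg]
  refine exists_congr fun ρ => and_congr_right fun _ => ?_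
  rw [neg_eq_iff_eq_neg]
  ring_nf

/-- **Lemma 2 of the paper.** For `1 ≤ r < s ≤ k`,
`-i(conj u_r - conj u_s) = 2k·sin(π(s-r)/k)·exp(i(2π/k - π(r+s)/k))` with
`sin(π(s-r)/k) > 0`; hence the Stokes ray `R_{rs}` is the open ray of argument
`2π/k - π(r+s)/k` and `R_{sr} = -R_{rs}`. -/
theorem stokes_rays_of_CP (k : ℕ) (hk : 2 ≤ k) (r s : ℕ)
    (hr : 1 ≤ r) (hrs : r < s) (hs : s ≤ k) :
    (-Complex.I * ((starRingEnd ℂ) (ucan k r) - (starRingEnd ℂ) (ucan k s))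
        = 2 * (k : ℂ) * (Real.sin (π * ((s : ℝ) - r) / k) : ℂ) *
            Complex.exp (Complex.I * (2 * (π : ℂ) / k - (π : ℂ) * ((r : ℂ) + s) / k))) ∧
    0 < Real.sin (π * ((s : ℝ) - r) / k) ∧
    stokesRay k r s = {z | ∃ ρ : ℝ, 0 < ρ ∧
      z = (ρ : ℂ) * Complex.exp (Complex.I * (2 * (π : ℂ) / k - (π : ℂ) * ((r : ℂ) + s) / k))} ∧
    stokesRay k s r = -(stokesRay k r s) := by
  have hsin := sin_pi_mul_sub_div_pos hr hrs hs
  have hdiff := neg_I_mul_conj_ucan_sub k r s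
  refine ⟨hdiff, hsin, ?_, stokesRay_swap k r s⟩
  have hc : 0 < 2 * (k : ℝ) * Real.sin (π * ((s : ℝ) - r) / k) := by positivity
  ext z
  constructor
  · rintro ⟨ρ, hρ, rfl⟩
    refine ⟨ρ * (2 * (k : ℝ) * Real.sin (π * ((s : ℝ) - r) / k)), mul_pos hρ hc, ?_⟩
    rw [mul_right_comm, hdiff]
    push_cast
    ring
  · rintro ⟨ρ, hρ, rfl⟩
    refine ⟨ρ / (2 * (k : ℝ) * Real.sin (π * ((s : ℝ) - r) / k)), div_pos hρ hc, ?_⟩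
    have hc' : 2 * (k : ℂ) * (Real.sin (π * ((s : ℝ) - r) / k) : ℂ) ≠ 0 := by
      exact_mod_cast hc.ne'
    rw [mul_right_comm, hdiff, Complex.ofReal_div, Complex.ofReal_mul, Complex.ofReal_mul,
      Complex.ofReal_ofNat, Complex.ofReal_natCast, mul_right_comm, mul_div_cancel₀ _ hc']
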